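/- There is no spectral set of size 28 in 𝔽_7^3. -/

import Mathlib

open Finset

/-- The character `x ↦ e^{2πi (x·a)/p}` on `𝔽_p^d`. -/
noncomputable def chr (p : ℕ) {d : ℕ} (a x : Fin d → ZMod p) : ℂ :=
  Complex.exp (2 * (Real.pi : ℂ) * Complex.I *
    ((ZMod.val (∑ i, x i * a i) : ℕ) : ℂ) / (p : ℂ))

/-- `(E, A)` is a spectral pair: the characters `χ_a`, `a ∈ A`, restricted to `E`,
are pairwise orthogonal, span `L²(E)`, and are linearly independent, i.e. they
form an orthogonal basis of `L²(E)`. -/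
def IsSpectralPair (p : ℕ) {d : ℕ} (E A : Finset (Fin d → ZMod p)) : Prop :=
  (∀ a ∈ A, ∀ b ∈ A, a ≠ b →
    ∑ x ∈ E, chr p a x * (starRingEnd ℂ) (chr p b x) = 0) ∧
  (∀ f : E → ℂ, ∃ c : A → ℂ, ∀ x : E, f x = ∑ a : A, c a * chr p a.1 x.1) ∧
  (∀ c : A → ℂ, (∀ x : E, ∑ a : A, c a * chr p a.1 x.1 = 0) → ∀ a, c a = 0)

/-- `E` is a spectral set. -/
def IsSpectral (p : ℕ) {d : ℕ} (E : Finset (Fin d → ZMod p)) : Prop :=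
  ∃ A, IsSpectralPair p E A

/-- `E` tiles `𝔽_p^d` by translation. -/
def Tiles (p : ℕ) {d : ℕ} (E : Finset (Fin d → ZMod p)) : Prop :=
  ∃ A : Finset (Fin d → ZMod p),
    ∀ x, (∑ a ∈ A, if x - a ∈ E then (1 : ℕ) else 0) = 1

/-- `E` determines the direction (one-dimensional subspace) `D`. -/
def Determines (p : ℕ) {d : ℕ} (E : Finset (Fin d → ZMod p))
    (D : Submodule (ZMod p) (Fin d → ZMod p)) : Prop :=
  ∃ e₁ ∈ E, ∃ e₂ ∈ E, e₁ ≠ e₂ ∧ e₁ - e₂ ∈ D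

/-- The Fourier transform of the indicator function of `E`. -/
noncomputable def ftE (p : ℕ) {d : ℕ} (E : Finset (Fin d → ZMod p))
    (ξ : Fin d → ZMod p) : ℂ :=
  ((p : ℂ) ^ d)⁻¹ * ∑ x ∈ E, Complex.exp (-(2 * (Real.pi : ℂ) * Complex.I *
    ((ZMod.val (∑ i, x i * ξ i) : ℕ) : ℂ) / (p : ℂ)))

/-- The orthogonal set `S^⊥ = {x : x · y = 0 for all y ∈ S}`. -/
def perpSet (p : ℕ) {d : ℕ} (S : Submodule (ZMod p) (Fin d → ZMod p)) :
    Set (Fin d → ZMod p) :=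
  {x | ∀ y ∈ S, ∑ i, x i * y i = 0}


namespace Sp
abbrev V := Fin 3 → ZMod 7

instance : Fact (Nat.Prime 7) := ⟨by norm_num⟩

/-- normalized representatives of projective points -/
def R : Finset V := univ.filter fun v =>
  v 0 = 1 ∨ (v 0 = 0 ∧ v 1 = 1) ∨ (v 0 = 0 ∧ v 1 = 0 ∧ v 2 = 1)

lemma mem_R (v : V) : v ∈ R ↔ (v 0 = 1 ∨ (v 0 = 0 ∧ v 1 = 1) ∨ (v 0 = 0 ∧ v 1 = 0 ∧ v 2 = 1)) := by
  simp [R]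

lemma R_ne {v : V} (h : v ∈ R) : v ≠ 0 := by
  rintro rfl
  simp [mem_R] at h

lemma exists_rep (v : V) (hv : v ≠ 0) : ∃ c : ZMod 7, c ≠ 0 ∧ ∃ d ∈ R, v = c • d := by
  have key : ∀ c : ZMod 7, c ≠ 0 → c⁻¹ • v ∈ R → ∃ c : ZMod 7, c ≠ 0 ∧ ∃ d ∈ R, v = c • d := by
    intro c hc h
    exact ⟨c, hc, _, h, by rw [smul_smul, mul_inv_cancel₀ hc, one_smul]⟩
  by_cases h0 : v 0 = 0
  · by_cases h1 : v 1 = 0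
    · by_cases h2 : v 2 = 0
      · exfalso; apply hv; ext i; fin_cases i <;> simp [h0, h1, h2]
      · exact key _ h2 (by simp [mem_R, h0, h1, h2])
    · exact key _ h1 (by simp [mem_R, h0, h1])
  · exact key _ h0 (by simp [mem_R, h0])

lemma R_unique {d d' : V} (h : d ∈ R) (h' : d' ∈ R) (c : ZMod 7) (e : d = c • d') : c = 1 := by
  rw [mem_R] at h h'
  subst e
  simp only [Pi.smul_apply, smul_eq_mul] at h
  have hc : c ≠ 0 := by rintro rfl; simp at h
  rcases h' with h' | ⟨h0, h1⟩ | ⟨h0, h1, h2⟩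
  · rw [h'] at h; simpa [hc] using h
  · rw [h0, h1] at h; simpa [hc] using h
  · rw [h0, h1, h2] at h; simpa [hc] using h

lemma R_indep {d d' : V} (h : d ∈ R) (h' : d' ∈ R) (hne : d ≠ d') (c : ZMod 7) : d ≠ c • d' := by
  intro e
  have := R_unique h h' c e
  subst this
  exact hne (by simpa using e)

lemma surj2 (w y : V) (hw : w ≠ 0) (hy : ∀ c : ZMod 7, y ≠ c • w) (s t : ZMod 7) :
    ∃ x : V, x ⬝ᵥ w = s ∧ x ⬝ᵥ y = t := by
  obtain ⟨i, hi⟩ := Function.ne_iff.1 hw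
  simp only [Pi.zero_apply] at hi
  set k := y i / w i with hk
  obtain ⟨j, hj⟩ := Function.ne_iff.1 (hy k)
  simp only [Pi.smul_apply, smul_eq_mul] at hj
  have hz : y j - k * w j ≠ 0 := sub_ne_zero.2 hj
  set b := (t - k * s) / (y j - k * w j) with hb
  refine ⟨Pi.single i ((s - b * w j) / w i) + Pi.single j b, ?_, ?_⟩
  · rw [add_dotProduct, single_dotProduct, single_dotProduct]
    field_simp
    ring
  · rw [add_dotProduct, single_dotProduct, single_dotProduct]
    have h1 : b * (y j - k * w j) = t - k * s := by rw [hb]; field_simp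
    have h2 : (s - b * w j) / w i * y i = (s - b * w j) * k := by rw [hk]; field_simp
    rw [h2]
    linear_combination h1

lemma fiber_card {G : Type*} [AddCommGroup G] [Fintype G] [DecidableEq G] (φ : V →+ G)
    (h : Function.Surjective φ) :
    343 = Fintype.card G * (univ.filter fun x => φ x = 0).card := by
  have h1 : (univ : Finset V).card = ∑ g : G, (univ.filter fun x => φ x = g).card :=
    Finset.card_eq_sum_card_fiberwise (fun _ _ => by simp)
  have h2 : ∀ g : G, (univ.filter fun x => φ x = g).card = (univ.filter fun x => φ x = 0).card := by
    intro g
    obtain ⟨x0, hx0⟩ := h g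
    apply Finset.card_bij (fun x _ => x - x0)
    · intro a ha; simp at ha ⊢; simp [ha, hx0]
    · intro a _ b _ hab; simpa using hab
    · intro b hb; simp at hb; exact ⟨b + x0, by simp [hb, hx0], by simp⟩
  simp only [h2] at h1
  simp at h1
  exact h1

lemma card_perp2 (w y : V) (hw : w ≠ 0) (hy : ∀ c : ZMod 7, y ≠ c • w) :
    (univ.filter fun x : V => x ⬝ᵥ w = 0 ∧ x ⬝ᵥ y = 0).card = 7 := by
  let φ : V →+ ZMod 7 × ZMod 7 :=
    { toFun := fun x => (x ⬝ᵥ w, x ⬝ᵥ y), map_zero' := by simp, map_add' := by simp [add_dotProduct] }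
  have h := fiber_card φ (by
    rintro ⟨s, t⟩
    obtain ⟨x, h1, h2⟩ := surj2 w y hw hy s t
    exact ⟨x, by simp [φ, h1, h2]⟩)
  simp [φ] at h
  omega

lemma exists_indep (w : V) : ∃ y : V, ∀ c : ZMod 7, y ≠ c • w := by
  by_contra hcon
  push Not at hcon
  obtain ⟨c0, h0⟩ := hcon (Pi.single 0 1)
  obtain ⟨c1, h1⟩ := hcon (Pi.single 1 1)
  have a := congrFun h0 0
  have b := congrFun h0 1
  have c := congrFun h1 1
  simp at a b c
  rcases b with b | b
  · simp [b] at a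
  · simp [b] at c

lemma card_perp1 (w : V) (hw : w ≠ 0) :
    (univ.filter fun x : V => x ⬝ᵥ w = 0).card = 49 := by
  obtain ⟨y, hy⟩ := exists_indep w
  let φ : V →+ ZMod 7 :=
    { toFun := fun x => x ⬝ᵥ w, map_zero' := by simp, map_add' := by simp [add_dotProduct] }
  have h := fiber_card φ (by
    rintro s
    obtain ⟨x, h1, h2⟩ := surj2 w y hw hy s 0
    exact ⟨x, by simp [φ, h1]⟩)
  simp [φ] at h
  omega

lemma card_R_mul (P : V → Prop) [DecidablePred P] (h0 : P 0)
    (hP : ∀ (c : ZMod 7) v, c ≠ 0 → (P (c • v) ↔ P v)) :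
    (univ.filter P).card = 6 * (R.filter P).card + 1 := by
  have h1 : (univ.filter P) = insert 0 ((univ.filter P).erase 0) := by
    rw [Finset.insert_erase]; simpa using h0
  rw [h1, Finset.card_insert_of_notMem (by simp)]
  congr 1
  have h6 : 6 = ((univ : Finset (ZMod 7)).erase 0).card := by decide
  have h7 : 6 * (R.filter P).card = (((univ : Finset (ZMod 7)).erase 0) ×ˢ (R.filter P)).card := by
    rw [Finset.card_product, ← h6]
  rw [h7]
  symm
  apply Finset.card_bij (fun p _ => p.1 • p.2)
  · rintro ⟨c, d⟩ h
    simp at h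
    simp [hP c d h.1, h.2.2, h.1, R_ne h.2.1]
  · rintro ⟨c, d⟩ h ⟨c', d'⟩ h' e
    simp at h h' e
    have e2 : d = (c⁻¹ * c') • d' := by
      rw [mul_smul, ← e, smul_smul, inv_mul_cancel₀ h.1, one_smul]
    have := R_unique h.2.1 h'.2.1 _ e2
    rw [this, one_smul] at e2
    have : c = c' := by
      field_simp [h.1] at this
      exact this.symm
    simp [this, e2]
  · intro v hv
    simp at hv
    obtain ⟨c, hc, d, hd, rfl⟩ := exists_rep v hv.1
    exact ⟨(c, d), by simp [hc, hd, (hP c d hc).1 hv.2], rfl⟩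

lemma R_card : R.card = 57 := by
  have := card_R_mul (fun _ => True) trivial (by simp)
  simp at this
  omega

lemma R_perp (w : V) (hw : w ≠ 0) : (R.filter fun d => d ⬝ᵥ w = 0).card = 8 := by
  have := card_R_mul (fun d => d ⬝ᵥ w = 0) (by simp) (by intro c v hc; simp [hc])
  have h2 := card_perp1 w hw
  have h3 : 49 = 6 * (R.filter fun d => d ⬝ᵥ w = 0).card + 1 := by
    rw [← this]; exact h2.symm
  omega

lemma R_perp2 (w y : V) (hw : w ≠ 0) (hy : ∀ c : ZMod 7, y ≠ c • w) :
    (R.filter fun d => d ⬝ᵥ w = 0 ∧ d ⬝ᵥ y = 0).card = 1 := by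
  have := card_R_mul (fun d => d ⬝ᵥ w = 0 ∧ d ⬝ᵥ y = 0) (by simp) (by intro c v hc; simp [hc])
  have h2 := card_perp2 w y hw hy
  have h3 : 7 = 6 * (R.filter fun d => d ⬝ᵥ w = 0 ∧ d ⬝ᵥ y = 0).card + 1 := by
    rw [← this]; exact h2.symm
  omega

lemma R_perp_ite (w y : V) (hw : w ≠ 0) :
    (R.filter fun d => d ⬝ᵥ w = 0 ∧ d ⬝ᵥ y = 0).card = if ∃ c : ZMod 7, y = c • w then 8 else 1 := by
  split_ifs with h
  · obtain ⟨c, rfl⟩ := h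
    rw [← R_perp w hw]
    congr 1
    ext d
    simp
    intro _ h
    simp [h]
  · push Not at h
    exact R_perp2 w y hw h

lemma span2 (w e f v : V) (hw : w ≠ 0) (he : e ⬝ᵥ w = 0) (hf : f ⬝ᵥ w = 0) (hv : v ⬝ᵥ w = 0)
    (he0 : e ≠ 0) (hi : ∀ c : ZMod 7, f ≠ c • e) : ∃ α β : ZMod 7, v = α • e + β • f := by
  have hinj : Function.Injective (fun p : ZMod 7 × ZMod 7 => p.1 • e + p.2 • f) := by
    rintro ⟨a, b⟩ ⟨a', b'⟩ h
    simp only at h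
    have h3 : (b - b') • f = (a' - a) • e := by
      rw [sub_smul, sub_smul]
      linear_combination (exp := 1) h
    have hb : b = b' := by
      by_contra hb
      have hb : b - b' ≠ 0 := sub_ne_zero.2 hb
      apply hi ((b - b')⁻¹ * (a' - a))
      rw [mul_smul, ← h3, smul_smul, inv_mul_cancel₀ hb, one_smul]
    subst hb
    rw [sub_self, zero_smul, eq_comm, smul_eq_zero] at h3
    rcases h3 with h3 | h3
    · rw [sub_eq_zero] at h3; simp [h3]
    · exact absurd h3 he0
  have himg : (univ.image (fun p : ZMod 7 × ZMod 7 => p.1 • e + p.2 • f)) =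
      univ.filter fun x : V => x ⬝ᵥ w = 0 := by
    apply Finset.eq_of_subset_of_card_le
    · intro x hx
      simp at hx
      obtain ⟨a, b, rfl⟩ := hx
      simp [add_dotProduct, he, hf]
    · rw [card_perp1 w hw, Finset.card_image_of_injective _ hinj]
      simp
  have : v ∈ univ.filter fun x : V => x ⬝ᵥ w = 0 := by simp [hv]
  rw [← himg] at this
  simp at this
  obtain ⟨a, b, h⟩ := this
  exact ⟨a, b, h.symm⟩

/-- plane counts -/
def cnt (E : Finset V) (d : V) (t : ZMod 7) : ℕ := (E.filter fun x => x ⬝ᵥ d = t).card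

lemma sum_cnt (E : Finset V) (d : V) : ∑ t, cnt E d t = E.card :=
  (Finset.card_eq_sum_card_fiberwise (fun _ _ => by simp)).symm

lemma sum_formula (E : Finset V) (w : V) (hw : w ≠ 0) (x : V) :
    ∑ d ∈ R with d ⬝ᵥ w = 0, cnt E d (x ⬝ᵥ d) =
      7 * (E.filter fun e => ∃ c : ZMod 7, e - x = c • w).card + E.card := by
  have h1 : ∑ d ∈ R with d ⬝ᵥ w = 0, cnt E d (x ⬝ᵥ d) =
      ∑ e ∈ E, (R.filter fun d => d ⬝ᵥ w = 0 ∧ d ⬝ᵥ (e - x) = 0).card := by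
    simp only [cnt, Finset.card_filter]
    rw [Finset.sum_comm]
    apply Finset.sum_congr rfl
    intro e _
    rw [Finset.sum_filter]
    apply Finset.sum_congr rfl
    intro d _
    have : (e ⬝ᵥ d = x ⬝ᵥ d) ↔ d ⬝ᵥ (e - x) = 0 := by
      rw [dotProduct_sub, sub_eq_zero, dotProduct_comm d, dotProduct_comm d]
    simp only [this, ite_and]
  rw [h1]
  simp only [R_perp_ite w _ hw]
  rw [Finset.sum_ite, Finset.sum_const, Finset.sum_const, smul_eq_mul, smul_eq_mul]
  have := Finset.card_filter_add_card_filter_not (s := E) (fun e => ∃ c : ZMod 7, e - x = c • w)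
  omega

/-- non-equidistributed directions -/
def N (E : Finset V) : Finset V := R.filter fun d => ∃ t, cnt E d t ≠ 4

lemma mem_N (E : Finset V) (d : V) : d ∈ N E ↔ d ∈ R ∧ ∃ t, cnt E d t ≠ 4 := by simp [N]

/-- non-equidistributed directions perpendicular to w -/
def NH (E : Finset V) (w : V) : Finset V := (N E).filter fun d => d ⬝ᵥ w = 0

lemma mem_NH (E : Finset V) (w d : V) : d ∈ NH E w ↔ d ∈ N E ∧ d ⬝ᵥ w = 0 := by simp [NH]

lemma NH_formula (E : Finset V) (hE : E.card = 28) (w : V) (hw : w ≠ 0) (x : V) :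
    ∃ f : ℕ, ∑ d ∈ NH E w, ((cnt E d (x ⬝ᵥ d) : ℤ) - 4) + 4 = 7 * f := by
  refine ⟨(E.filter fun e => ∃ c : ZMod 7, e - x = c • w).card, ?_⟩
  have h := sum_formula E w hw x
  have h1 : ∑ d ∈ NH E w, ((cnt E d (x ⬝ᵥ d) : ℤ) - 4) =
      ∑ d ∈ R with d ⬝ᵥ w = 0, ((cnt E d (x ⬝ᵥ d) : ℤ) - 4) := by
    apply Finset.sum_subset
    · intro d hd
      rw [mem_NH, mem_N] at hd
      simp [hd.1.1, hd.2]
    · intro d hd hd2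
      rw [mem_NH, mem_N] at hd2
      simp at hd
      have : cnt E d (x ⬝ᵥ d) = 4 := by
        by_contra hc
        exact hd2 ⟨⟨hd.1, _, hc⟩, hd.2⟩
      rw [this]; norm_num
  rw [h1, Finset.sum_sub_distrib, Finset.sum_const, R_perp w hw]
  rw [hE] at h
  have h' : ∑ d ∈ R with d ⬝ᵥ w = 0, (cnt E d (x ⬝ᵥ d) : ℤ) = 7 * (E.filter fun e => ∃ c : ZMod 7, e - x = c • w).card + 28 := by
    exact_mod_cast h
  rw [h']
  simp
  ring

lemma NH_pos (E : Finset V) (hE : E.card = 28) (w : V) (hw : w ≠ 0) : (NH E w).card ≠ 0 := by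
  intro h
  rw [Finset.card_eq_zero] at h
  obtain ⟨f, hf⟩ := NH_formula E hE w hw 0
  rw [h] at hf
  simp at hf
  omega

/-- duality hypotheses -/
def Dual (E A : Finset V) : Prop :=
  ∀ a ∈ A, ∀ b ∈ A, a ≠ b → ∀ t, cnt E (a - b) t = 4

lemma dual_dir {E A : Finset V} (h : Dual E A) {a b d : V} {c : ZMod 7} (ha : a ∈ A) (hb : b ∈ A)
    (hab : a ≠ b) (e : a - b = c • d) : d ∉ N E := by
  intro hd
  rw [mem_N] at hd
  obtain ⟨_, t, ht⟩ := hd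
  apply ht
  have hc : c ≠ 0 := by
    rintro rfl
    apply hab
    simpa [sub_eq_zero] using e
  rw [← h a ha b hb hab (c * t), e]
  unfold cnt
  congr 1
  ext x
  simp [hc]

lemma cnt_le (E A : Finset V) (hA : A.card = 28) (h : Dual A E) (w : V) (hw : w ≠ 0)
    (t : ZMod 7) : cnt E w t ≤ 7 := by
  by_contra hcon
  push Not at hcon
  apply NH_pos A hA w hw
  rw [Finset.card_eq_zero, Finset.eq_empty_iff_forall_notMem]
  intro d hd
  rw [mem_NH] at hd
  obtain ⟨hdN, hdw⟩ := hd
  have hdR := ((mem_N _ _).1 hdN).1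
  have hd0 := R_ne hdR
  -- choose u
  obtain ⟨u, hu, hui⟩ : ∃ u : V, u ⬝ᵥ d = 0 ∧ ∀ c : ZMod 7, u ≠ c • w := by
    by_contra hc
    push Not at hc
    have h1 : (univ.filter fun u : V => u ⬝ᵥ d = 0) ⊆ univ.image fun c : ZMod 7 => c • w := by
      intro u hu
      simp at hu
      obtain ⟨c, hc⟩ := hc u hu
      simp
      exact ⟨c, hc.symm⟩
    have h2 := (Finset.card_le_card h1).trans Finset.card_image_le
    rw [card_perp1 d hd0] at h2
    simp at h2
  obtain ⟨x, hx, y, hy, hxy, he⟩ := Finset.exists_ne_map_eq_of_card_lt_of_maps_to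
    (s := E.filter fun x => x ⬝ᵥ w = t) (t := (univ : Finset (ZMod 7))) (f := fun x => x ⬝ᵥ u)
    (by simpa [cnt] using hcon) (by intro x hx; simp)
  simp at hx hy he
  have hd1 : d ⬝ᵥ u = 0 := by rw [dotProduct_comm]; exact hu
  have hxy0 : x - y ≠ 0 := sub_ne_zero.2 hxy
  obtain ⟨c, hc, d', hd', e⟩ := exists_rep _ hxy0
  have h1 := R_perp2 w u hw hui
  rw [Finset.card_eq_one] at h1
  obtain ⟨z, hz⟩ := h1
  have m1 : d ∈ ({z} : Finset V) := by rw [← hz]; simp [hdR, hdw, hd1]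
  have m2 : d' ∈ ({z} : Finset V) := by
    rw [← hz]
    have e1 : (x - y) ⬝ᵥ w = 0 := by rw [sub_dotProduct, hx.2, hy.2, sub_self]
    have e2 : (x - y) ⬝ᵥ u = 0 := by rw [sub_dotProduct, he, sub_self]
    rw [e] at e1 e2
    simp [hc] at e1 e2
    simp [hd', e1, e2]
  simp at m1 m2
  rw [m2, ← m1] at e
  exact dual_dir h hx.1 hy.1 hxy e hdN

/-- the four-direction lemma in coordinates -/
lemma four_dir : ∀ α β : ZMod 7, (α, β) ≠ (0, 0) → (α, β) ≠ (1, 0) → (α, β) ≠ (0, 1) →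
    (α ≠ 0 ∧ β ≠ 0 ∧ α + β ≠ 0) ∨ (α - 1 ≠ 0 ∧ β ≠ 0 ∧ α - 1 + β ≠ 0) ∨
    (α ≠ 0 ∧ β - 1 ≠ 0 ∧ α + (β - 1) ≠ 0) := by decide

open Classical in
/-- directions determined by A in w-perp -/
noncomputable def DH (A : Finset V) (w : V) : Finset V :=
  R.filter fun d => d ⬝ᵥ w = 0 ∧ ∃ a ∈ A, ∃ b ∈ A, a ≠ b ∧ ∃ c : ZMod 7, a - b = c • d

lemma DH_card (A : Finset V) (w : V) (hw : w ≠ 0) (e f : V) (he : e ⬝ᵥ w = 0) (hf : f ⬝ᵥ w = 0)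
    (he0 : e ≠ 0) (hi : ∀ c : ZMod 7, f ≠ c • e) (a0 a3 : V) (h0 : a0 ∈ A) (h1 : a0 + e ∈ A)
    (h2 : a0 + f ∈ A) (h3 : a3 ∈ A) (h30 : a3 ≠ a0) (h31 : a3 ≠ a0 + e) (h32 : a3 ≠ a0 + f)
    (hv : (a3 - a0) ⬝ᵥ w = 0) : 4 ≤ (DH A w).card := by
  -- independence in coordinates
  have ind : ∀ a b : ZMod 7, a • e + b • f = 0 → a = 0 ∧ b = 0 := by
    intro a b h
    have hb : b = 0 := by
      by_contra hb
      apply hi (-(b⁻¹ * a))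
      have : b • f = -(a • e) := by rw [eq_neg_iff_add_eq_zero, add_comm]; exact h
      rw [neg_smul, mul_smul, ← smul_neg, ← this, smul_smul, inv_mul_cancel₀ hb, one_smul]
    subst hb
    simp only [zero_smul, add_zero, smul_eq_zero, he0, or_false] at h
    exact ⟨h, rfl⟩
  -- a direction for each difference
  have rep : ∀ p q : ZMod 7, (p, q) ≠ (0, 0) → (∃ a ∈ A, ∃ b ∈ A, a - b = p • e + q • f) →
      ∃ d ∈ DH A w, ∃ c : ZMod 7, c ≠ 0 ∧ p • e + q • f = c • d := by
    rintro p q hpq ⟨a, ha, b, hb, hab⟩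
    have hne : p • e + q • f ≠ 0 := by
      intro h
      obtain ⟨rfl, rfl⟩ := ind _ _ h
      exact hpq rfl
    obtain ⟨c, hc, d, hd, hcd⟩ := exists_rep _ hne
    refine ⟨d, ?_, c, hc, hcd⟩
    have hperp : (c • d) ⬝ᵥ w = 0 := by
      rw [← hcd]; simp [add_dotProduct, he, hf]
    simp [hc] at hperp
    simp only [DH, Finset.mem_filter]
    refine ⟨hd, hperp, a, ha, b, hb, ?_, c, hab.trans hcd⟩
    rintro rfl
    rw [sub_self] at hab
    exact hne hab.symm
  have dist : ∀ p q p' q' c c' : ZMod 7, ∀ d d' : V, c ≠ 0 → c' ≠ 0 → p • e + q • f = c • d →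
      p' • e + q' • f = c' • d' → p * q' - q * p' ≠ 0 → d ≠ d' := by
    rintro p q p' q' c c' d d' hc hc' h h' hdet rfl
    have : (c' * p - c * p') • e + (c' * q - c * q') • f = 0 := by
      have : c' • (p • e + q • f) = c • (p' • e + q' • f) := by
        rw [h, h', smul_smul, smul_smul, mul_comm]
      rw [← sub_eq_zero] at this
      rw [← this]
      module
    obtain ⟨e1, e2⟩ := ind _ _ this
    apply hdet
    have : c' * (p * q' - q * p') = 0 := by linear_combination q' * e1 - p' * e2
    simpa [hc'] using this
  obtain ⟨α, β, hαβ⟩ := span2 w e f _ hw he hf hv he0 hi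
  have g : ∃ p q : ZMod 7, (∃ a ∈ A, ∃ b ∈ A, a - b = p • e + q • f) ∧ p ≠ 0 ∧ q ≠ 0 ∧ p + q ≠ 0 := by
    have n0 : (α, β) ≠ (0, 0) := by
      intro h; simp at h; rw [h.1, h.2] at hαβ; simp [sub_eq_zero] at hαβ; exact h30 hαβ
    have n1 : (α, β) ≠ (1, 0) := by
      intro h; simp at h; rw [h.1, h.2] at hαβ; simp [sub_eq_iff_eq_add'] at hαβ; exact h31 hαβ
    have n2 : (α, β) ≠ (0, 1) := by
      intro h; simp at h; rw [h.1, h.2] at hαβ; simp [sub_eq_iff_eq_add'] at hαβ; exact h32 hαβ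
    rcases four_dir α β n0 n1 n2 with h | h | h
    · exact ⟨α, β, ⟨a3, h3, a0, h0, hαβ⟩, h⟩
    · refine ⟨α - 1, β, ⟨a3, h3, a0 + e, h1, ?_⟩, h⟩
      rw [← sub_sub, hαβ]; module
    · refine ⟨α, β - 1, ⟨a3, h3, a0 + f, h2, ?_⟩, h⟩
      rw [← sub_sub, hαβ]; module
  obtain ⟨p, q, hpq, hp, hq, hs⟩ := g
  obtain ⟨d1, m1, c1, k1, l1⟩ := rep 1 0 (by decide) ⟨a0 + e, h1, a0, h0, by module⟩
  obtain ⟨d2, m2, c2, k2, l2⟩ := rep 0 1 (by decide) ⟨a0 + f, h2, a0, h0, by module⟩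
  obtain ⟨d3, m3, c3, k3, l3⟩ := rep (-1) 1 (by decide) ⟨a0 + f, h2, a0 + e, h1, by module⟩
  obtain ⟨d4, m4, c4, k4, l4⟩ := rep p q (by simp [hp]) hpq
  have n12 := dist _ _ _ _ _ _ _ _ k1 k2 l1 l2 (by decide)
  have n13 := dist _ _ _ _ _ _ _ _ k1 k3 l1 l3 (by decide)
  have n23 := dist _ _ _ _ _ _ _ _ k2 k3 l2 l3 (by decide)
  have n14 := dist _ _ _ _ _ _ _ _ k1 k4 l1 l4 (by simpa using hq)
  have n24 := dist _ _ _ _ _ _ _ _ k2 k4 l2 l4 (by simpa using hp)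
  have n34 := dist _ _ _ _ _ _ _ _ k3 k4 l3 l4 (by
    intro h; apply hs; linear_combination -h)
  have hsub : ({d1, d2, d3, d4} : Finset V) ⊆ DH A w := by
    intro x hx
    simp at hx
    rcases hx with rfl | rfl | rfl | rfl <;> assumption
  have hc4 : ({d1, d2, d3, d4} : Finset V).card = 4 := by
    rw [Finset.card_insert_of_notMem (by simp [n12, n13, n14]),
      Finset.card_insert_of_notMem (by simp [n23, n24]), Finset.card_pair n34]
  rw [← hc4]
  exact Finset.card_le_card hsub

lemma DH_four (E A : Finset V) (hE : E.card = 28) (hA : A.card = 28) (h : Dual E A) (w : V) (hwR : w ∈ R) :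
    4 ≤ (DH A w).card := by
  have hw := R_ne hwR
  have hle := fun u hu t => cnt_le A E hE h u hu t
  obtain ⟨t, ht⟩ : ∃ t, 4 ≤ cnt A w t := by
    by_contra hc
    push Not at hc
    have h1 := sum_cnt A w
    have h2 : ∑ t, cnt A w t ≤ ∑ t : ZMod 7, 3 := Finset.sum_le_sum (fun t _ => by have := hc t; omega)
    rw [h1, hA] at h2
    simp at h2
  set S := A.filter fun x => x ⬝ᵥ w = t with hS
  have hSc : 4 ≤ S.card := ht
  have memS : ∀ x, x ∈ S ↔ x ∈ A ∧ x ⬝ᵥ w = t := by intro x; simp [hS]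
  obtain ⟨a0, ha0⟩ : S.Nonempty := Finset.card_pos.1 (by omega)
  obtain ⟨a1, ha1, hne⟩ := Finset.exists_mem_ne (by omega : 1 < S.card) a0
  set e := a1 - a0 with he
  have he0 : e ≠ 0 := sub_ne_zero.2 hne
  have hperp : ∀ x ∈ S, (x - a0) ⬝ᵥ w = 0 := by
    intro x hx
    rw [sub_dotProduct, ((memS x).1 hx).2, ((memS a0).1 ha0).2, sub_self]
  obtain ⟨a2, ha2, hi⟩ : ∃ a2 ∈ S, ∀ c : ZMod 7, a2 - a0 ≠ c • e := by
    by_contra hcon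
    push Not at hcon
    have hf := sum_formula A e he0 a0
    have hwe : w ∈ R.filter fun d => d ⬝ᵥ e = 0 := by
      simp [hwR]
      rw [dotProduct_comm]; exact hperp a1 ha1
    rw [← Finset.add_sum_erase _ _ hwe] at hf
    have h2 : ∑ x ∈ (R.filter fun d => d ⬝ᵥ e = 0).erase w, cnt A x (a0 ⬝ᵥ x) ≤
        ∑ x ∈ (R.filter fun d => d ⬝ᵥ e = 0).erase w, 7 := by
      apply Finset.sum_le_sum
      intro u hu
      simp at hu
      exact hle u (R_ne hu.2.1) _
    rw [Finset.sum_const, Finset.card_erase_of_mem hwe, R_perp e he0] at h2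
    have h3 : cnt A w (a0 ⬝ᵥ w) = S.card := by
      rw [((memS a0).1 ha0).2]; rfl
    have h4 : S.card ≤ (A.filter fun x => ∃ c : ZMod 7, x - a0 = c • e).card := by
      apply Finset.card_le_card
      intro x hx
      rw [Finset.mem_filter]
      exact ⟨((memS x).1 hx).1, hcon x hx⟩
    have fin : ∀ s X Y k : ℕ, s + X = 7 * Y + k → X ≤ (8 - 1) • 7 → s ≤ Y → k = 28 → 4 ≤ s → False := by
      intro s X Y k h1 h2 h3 h4 h5
      simp at h2
      omega
    rw [h3] at hf
    exact fin _ _ _ _ hf h2 h4 hA hSc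
  obtain ⟨a3, ha3, hn3⟩ : ∃ a3 ∈ S, a3 ∉ ({a0, a1, a2} : Finset V) := by
    apply Finset.exists_mem_notMem_of_card_lt_card
    exact lt_of_le_of_lt Finset.card_le_three (by omega)
  simp at hn3
  have e1 : a0 + e = a1 := by rw [he]; abel
  have e2 : a0 + (a2 - a0) = a2 := by abel
  refine DH_card A w hw e (a2 - a0) (hperp a1 ha1) (hperp a2 ha2) he0 hi a0 a3 ((memS _).1 ha0).1 ?_ ?_
    ((memS _).1 ha3).1 hn3.1 ?_ ?_ (hperp a3 ha3)
  · rw [e1]; exact ((memS _).1 ha1).1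
  · rw [e2]; exact ((memS _).1 ha2).1
  · rw [e1]; exact hn3.2.1
  · rw [e2]; exact hn3.2.2

lemma NH_le (E A : Finset V) (hE : E.card = 28) (hA : A.card = 28) (h : Dual E A) (w : V) (hwR : w ∈ R) :
    (NH E w).card ≤ 4 := by
  have h4 := DH_four E A hE hA h w hwR
  have hd : Disjoint (NH E w) (DH A w) := by
    rw [Finset.disjoint_left]
    intro d hd hd2
    simp only [DH, Finset.mem_filter] at hd2
    obtain ⟨_, _, a, ha, b, hb, hab, c, hc⟩ := hd2
    exact dual_dir h ha hb hab hc ((mem_NH _ _ _).1 hd).1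
  have hs : NH E w ∪ DH A w ⊆ R.filter fun d => d ⬝ᵥ w = 0 := by
    intro d hd
    rw [Finset.mem_union, mem_NH, mem_N] at hd
    simp only [DH, Finset.mem_filter] at hd ⊢
    tauto
  have := Finset.card_le_card hs
  rw [Finset.card_union_of_disjoint hd, R_perp w (R_ne hwR)] at this
  omega

/-- sum of squares of plane counts -/
def sq (E : Finset V) (d : V) : ℤ := ∑ t, (cnt E d t : ℤ) ^ 2

lemma type_B (G : ZMod 7 → ℕ) (hs : ∑ t, G t = 28) (hle : ∀ t, G t ≤ 7)
    (hm : ∀ t, (G t : ZMod 7) = 0) : ∑ t, (G t : ℤ) ^ 2 = 196 := by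
  have : ∀ t, (G t : ℤ) ^ 2 = 7 * G t := by
    intro t
    have h1 := (ZMod.natCast_eq_zero_iff (G t) 7).1 (hm t)
    have h2 := hle t
    generalize G t = g at *
    interval_cases g <;> omega
  simp only [this]
  rw [← Finset.mul_sum]
  have h : ∑ t, (G t : ℤ) = 28 := by exact_mod_cast hs
  rw [h]; norm_num

lemma type_const (G : ZMod 7 → ℕ) (hs : ∑ t, G t = 28) (hle : ∀ t, G t ≤ 7)
    (hN : ∃ t, G t ≠ 4) (k : ZMod 7) (hm : ∀ t, (G t : ZMod 7) = k) : k = 0 := by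
  by_contra hk
  have hu : ∀ t, G t = k.val := by
    intro t
    have h1 := hm t
    have h2 := hle t
    have h3 : G t ≠ 7 := by
      intro h; rw [h] at h1; exact hk (h1.symm.trans (by decide))
    rw [← h1, ZMod.val_natCast, Nat.mod_eq_of_lt (by omega)]
  have : ∑ t, G t = ∑ t : ZMod 7, k.val := Finset.sum_congr rfl (fun t _ => hu t)
  rw [hs] at this
  simp at this
  obtain ⟨t, ht⟩ := hN
  apply ht
  rw [hu t]; omega

lemma type_P (G : ZMod 7 → ℕ) (hs : ∑ t, G t = 28) (hle : ∀ t, G t ≤ 7)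
    (k c : ZMod 7) (hc : c ≠ 0) (hm : ∀ t, (G t : ZMod 7) = k + c * t) :
    ∑ t, (G t : ℤ) ^ 2 = 140 := by
  let φ : ZMod 7 ≃ ZMod 7 :=
    ⟨fun s => (s - k) / c, fun t => k + c * t, fun s => by field_simp; ring, fun t => by field_simp; ring⟩
  have e1 : ∑ s, G (φ s) = 28 := by rw [← hs]; exact Equiv.sum_comp φ G
  have e2 : ∑ s, (G (φ s) : ℤ) ^ 2 = ∑ t, (G t : ℤ) ^ 2 := Equiv.sum_comp φ (fun t => (G t : ℤ) ^ 2)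
  rw [← e2]
  have hv : ∀ s, (G (φ s) : ZMod 7) = s := by
    intro s
    rw [hm]
    exact φ.symm_apply_apply s
  have hmod : ∀ s, G (φ s) % 7 = s.val := by
    intro s
    rw [← ZMod.val_natCast, hv s]
  have hl : ∀ s, G (φ s) ≤ 7 := fun s => hle _
  have key : ∀ g : ZMod 7 → ℕ, (∀ s, g s % 7 = s.val) → (∀ s, g s ≤ 7) → ∑ s, g s = 28 →
      ∑ s, (g s : ℤ) ^ 2 = 140 := by
    intro g h1 h2 h3
    have a0 : g 0 % 7 = 0 := h1 0
    have a1 : g 1 % 7 = 1 := h1 1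
    have a2 : g 2 % 7 = 2 := h1 2
    have a3 : g 3 % 7 = 3 := h1 3
    have a4 : g 4 % 7 = 4 := h1 4
    have a5 : g 5 % 7 = 5 := h1 5
    have a6 : g 6 % 7 = 6 := h1 6
    have sumN : ∑ s, g s = g 0 + g 1 + g 2 + g 3 + g 4 + g 5 + g 6 := Fin.sum_univ_seven g
    have sumZ : ∑ s, (g s : ℤ) ^ 2 = (g 0 : ℤ) ^ 2 + (g 1 : ℤ) ^ 2 + (g 2 : ℤ) ^ 2 + (g 3 : ℤ) ^ 2
       + (g 4 : ℤ) ^ 2 + (g 5 : ℤ) ^ 2 + (g 6 : ℤ) ^ 2 := Fin.sum_univ_seven (fun s => (g s : ℤ) ^ 2)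
    rw [sumN] at h3
    have l0 := h2 0
    have l1 := h2 1
    have l2 := h2 2
    have l3 := h2 3
    have l4 := h2 4
    have l5 := h2 5
    have l6 := h2 6
    have b1 : g 1 = 1 := by omega
    have b2 : g 2 = 2 := by omega
    have b3 : g 3 = 3 := by omega
    have b4 : g 4 = 4 := by omega
    have b5 : g 5 = 5 := by omega
    have b6 : g 6 = 6 := by omega
    have b0 : g 0 = 7 := by omega
    rw [sumZ, b0, b1, b2, b3, b4, b5, b6]
    norm_num
  exact key (fun s => G (φ s)) hmod hl e1

lemma affine (g : ZMod 7 → ZMod 7) (h : ∀ u v, g (u + v) = g u + g v - g 0) :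
    ∃ c, ∀ u, g u = g 0 + c * u := by
  refine ⟨g 1 - g 0, ?_⟩
  intro u
  obtain ⟨n, rfl⟩ := ZMod.natCast_zmod_surjective u
  induction n with
  | zero => simp
  | succ n ih =>
    push_cast
    rw [h, ih]
    ring

lemma three (G1 G2 G3 : ZMod 7 → ℕ) (s1 : ∑ t, G1 t = 28) (s2 : ∑ t, G2 t = 28) (s3 : ∑ t, G3 t = 28)
    (l1 : ∀ t, G1 t ≤ 7) (l2 : ∀ t, G2 t ≤ 7) (l3 : ∀ t, G3 t ≤ 7)
    (n1 : ∃ t, G1 t ≠ 4) (n2 : ∃ t, G2 t ≠ 4) (n3 : ∃ t, G3 t ≠ 4)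
    (α β : ZMod 7) (hα : α ≠ 0) (hβ : β ≠ 0)
    (h : ∀ s t, (G1 s : ZMod 7) + G2 t + G3 (α * s + β * t) = 1) :
    ∑ t, (G1 t : ℤ) ^ 2 = 140 ∧ ∑ t, (G2 t : ℤ) ^ 2 = 140 ∧ ∑ t, (G3 t : ℤ) ^ 2 = 140 := by
  obtain ⟨c, hc⟩ := affine (fun t => (G3 t : ZMod 7)) (by
    intro u v
    have a1 := h (u / α) (v / β)
    have a2 := h (u / α) 0
    have a3 := h 0 (v / β)
    have a4 := h 0 0
    have eu : α * (u / α) = u := by field_simp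
    have ev : β * (v / β) = v := by field_simp
    simp only [eu, ev, mul_zero, add_zero, zero_add] at a1 a2 a3 a4
    linear_combination a1 - a2 - a3 + a4)
  have h1 : ∀ s, (G1 s : ZMod 7) = (1 - G2 0 - G3 0) + (-(c * α)) * s := by
    intro s
    have := h s 0
    rw [hc] at this
    linear_combination this
  have h2 : ∀ s, (G2 s : ZMod 7) = (1 - G1 0 - G3 0) + (-(c * β)) * s := by
    intro s
    have := h 0 s
    rw [hc] at this
    linear_combination this
  by_cases hc0 : c = 0
  · exfalso
    subst hc0
    have k1 := type_const G1 s1 l1 n1 (1 - G2 0 - G3 0) (fun t => (h1 t).trans (by ring))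
    have k2 := type_const G2 s2 l2 n2 (1 - G1 0 - G3 0) (fun t => (h2 t).trans (by ring))
    have k3 := type_const G3 s3 l3 n3 (G3 0) (fun t => (hc t).trans (by ring))
    have := h 0 0
    simp only [mul_zero, add_zero] at this
    have h10 : (1 : ZMod 7) = 0 := by linear_combination this + k1 + k2 + k3
    exact absurd h10 (by decide)
  · exact ⟨type_P G1 s1 l1 _ _ (by simp [hc0, hα]) h1, type_P G2 s2 l2 _ _ (by simp [hc0, hβ]) h2,
      type_P G3 s3 l3 _ _ hc0 hc⟩

lemma NH_cast (E : Finset V) (hE : E.card = 28) (w : V) (hw : w ≠ 0) (x : V) :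
    ∑ d ∈ NH E w, ((cnt E d (x ⬝ᵥ d) : ZMod 7) - 4) + 4 = 0 := by
  obtain ⟨f, hf⟩ := NH_formula E hE w hw x
  have := congrArg (Int.cast : ℤ → ZMod 7) hf
  push_cast at this
  rw [this]
  have : (7 : ZMod 7) = 0 := by decide
  rw [this, zero_mul]

lemma NH_types (E A : Finset V) (hE : E.card = 28) (hA : A.card = 28) (h : Dual E A) (h' : Dual A E)
    (w : V) (hwR : w ∈ R) :
    ((NH E w).card = 1 ∧ ∀ d ∈ NH E w, sq E d = 196) ∨
    ((NH E w).card = 3 ∧ ∀ d ∈ NH E w, sq E d = 140) ∨ (NH E w).card = 4 := by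
  have hw := R_ne hwR
  have k0 := NH_pos E hE w hw
  have k4 := NH_le E A hE hA h w hwR
  have hf := NH_cast E hE w hw
  have prop : ∀ d ∈ NH E w, d ∈ R ∧ d ⬝ᵥ w = 0 ∧ (∃ t, cnt E d t ≠ 4) ∧ ∑ t, cnt E d t = 28 ∧
      ∀ t, cnt E d t ≤ 7 := by
    intro d hd
    rw [mem_NH, mem_N] at hd
    exact ⟨hd.1.1, hd.2, hd.1.2, by rw [sum_cnt, hE], cnt_le E A hA h' d (R_ne hd.1.1)⟩
  have cases4 : (NH E w).card = 1 ∨ (NH E w).card = 2 ∨ (NH E w).card = 3 ∨ (NH E w).card = 4 := by omega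
  rcases cases4 with hk | hk | hk | hk
  · left
    refine ⟨hk, ?_⟩
    obtain ⟨d, hd⟩ := Finset.card_eq_one.1 hk
    rw [hd] at hf prop ⊢
    intro d' hd'
    rw [Finset.mem_singleton] at hd'
    subst hd'
    obtain ⟨p1, p2, p3, p4, p5⟩ := prop d' (by simp)
    apply type_B _ p4 p5
    intro t
    obtain ⟨y, hy⟩ := exists_indep d'
    obtain ⟨x, hx, _⟩ := surj2 d' y (R_ne p1) hy t 0
    have := hf x
    rw [Finset.sum_singleton, hx] at this
    linear_combination this
  · exfalso
    obtain ⟨d1, d2, hne, hd⟩ := Finset.card_eq_two.1 hk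
    rw [hd] at hf prop
    obtain ⟨p1, p2, p3, p4, p5⟩ := prop d1 (by simp)
    obtain ⟨q1, q2, q3, q4, q5⟩ := prop d2 (by simp)
    have hst : ∀ s t, (cnt E d1 s : ZMod 7) + cnt E d2 t = 4 := by
      intro s t
      obtain ⟨x, hx, hx2⟩ := surj2 d1 d2 (R_ne p1) (R_indep q1 p1 hne.symm) s t
      have := hf x
      rw [Finset.sum_pair hne, hx, hx2] at this
      linear_combination this
    have c1 := type_const _ p4 p5 p3 (4 - cnt E d2 0) (fun t => by linear_combination hst t 0)
    have c2 := type_const _ q4 q5 q3 (4 - cnt E d1 0) (fun t => by linear_combination hst 0 t)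
    have c3 := hst 0 0
    have : (4 : ZMod 7) = 0 := by linear_combination c1 + c2 + c3
    exact absurd this (by decide)
  · right; left
    refine ⟨hk, ?_⟩
    obtain ⟨d1, d2, d3, n12, n13, n23, hd⟩ := Finset.card_eq_three.1 hk
    rw [hd] at hf prop ⊢
    obtain ⟨p1, p2, p3, p4, p5⟩ := prop d1 (by simp)
    obtain ⟨q1, q2, q3, q4, q5⟩ := prop d2 (by simp)
    obtain ⟨r1, r2, r3, r4, r5⟩ := prop d3 (by simp)
    obtain ⟨α, β, hαβ⟩ := span2 w d1 d2 d3 hw p2 q2 r2 (R_ne p1) (R_indep q1 p1 n12.symm)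
    have hα : α ≠ 0 := by
      rintro rfl
      exact R_indep r1 q1 n23.symm β (by simpa using hαβ)
    have hβ : β ≠ 0 := by
      rintro rfl
      exact R_indep r1 p1 n13.symm α (by simpa using hαβ)
    have := three (cnt E d1) (cnt E d2) (cnt E d3) p4 q4 r4 p5 q5 r5 p3 q3 r3 α β hα hβ (by
      intro s t
      obtain ⟨x, hx, hx2⟩ := surj2 d1 d2 (R_ne p1) (R_indep q1 p1 n12.symm) s t
      have hx3 : x ⬝ᵥ d3 = α * s + β * t := by
        rw [hαβ, dotProduct_add, dotProduct_smul, dotProduct_smul, hx, hx2]; rfl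
      have := hf x
      rw [Finset.sum_insert (by simp [n12, n13]), Finset.sum_pair n23, hx, hx2, hx3] at this
      have h7 : (7 : ZMod 7) = 0 := by decide
      linear_combination this + h7)
    intro d hd'
    simp at hd'
    rcases hd' with rfl | rfl | rfl
    · exact this.1
    · exact this.2.1
    · exact this.2.2
  · right; right; exact hk

lemma sum_sq_all (E : Finset V) (hE : E.card = 28) : ∑ d ∈ R, sq E d = 7644 := by
  have h1 : ∀ d, sq E d = ∑ x ∈ E, ∑ y ∈ E, if d ⬝ᵥ (x - y) = 0 then (1 : ℤ) else 0 := by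
    intro d
    have : ∀ x y : V, (d ⬝ᵥ (x - y) = 0) ↔ y ⬝ᵥ d = x ⬝ᵥ d := by
      intro x y
      rw [dotProduct_sub, sub_eq_zero, dotProduct_comm d, dotProduct_comm d, eq_comm]
    simp only [this]
    have h2 : ∀ x, (∑ y ∈ E, if y ⬝ᵥ d = x ⬝ᵥ d then (1 : ℤ) else 0) = cnt E d (x ⬝ᵥ d) := by
      intro x
      rw [cnt, Finset.card_filter]; push_cast; rfl
    simp only [h2]
    rw [← Finset.sum_fiberwise E (fun x => x ⬝ᵥ d) (fun x => (cnt E d (x ⬝ᵥ d) : ℤ))]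
    unfold sq
    apply Finset.sum_congr rfl
    intro t _
    rw [Finset.sum_congr rfl (g := fun _ => (cnt E d t : ℤ))
      (by intro x hx; simp at hx; rw [hx.2])]
    rw [Finset.sum_const, nsmul_eq_mul, pow_two]
    rfl
  simp only [h1]
  rw [Finset.sum_comm]
  have h3 : ∀ x ∈ E, ∑ d ∈ R, ∑ y ∈ E, (if d ⬝ᵥ (x - y) = 0 then (1 : ℤ) else 0) = 273 := by
    intro x hx
    rw [Finset.sum_comm]
    rw [← Finset.add_sum_erase _ _ hx]
    have h4 : ∀ y ∈ E.erase x, ∑ d ∈ R, (if d ⬝ᵥ (x - y) = 0 then (1 : ℤ) else 0) = 8 := by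
      intro y hy
      have hne : x - y ≠ 0 := sub_ne_zero.2 (Finset.ne_of_mem_erase hy).symm
      have := R_perp (x - y) hne
      rw [Finset.card_filter] at this
      exact_mod_cast this
    rw [Finset.sum_congr rfl h4, Finset.sum_const, Finset.card_erase_of_mem hx, hE]
    simp [R_card]
  rw [Finset.sum_congr rfl h3, Finset.sum_const, hE]
  norm_num

lemma sum_sq_N (E : Finset V) (hE : E.card = 28) : ∑ d ∈ N E, (sq E d - 112) = 1260 := by
  have h1 : ∑ d ∈ N E, (sq E d - 112) = ∑ d ∈ R, (sq E d - 112) := by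
    apply Finset.sum_subset
    · intro d hd; exact ((mem_N _ _).1 hd).1
    · intro d hd hn
      rw [mem_N] at hn
      push Not at hn
      have := hn hd
      simp [sq, this]
  rw [h1, Finset.sum_sub_distrib, sum_sq_all E hE, Finset.sum_const, R_card]
  norm_num

lemma comm_sum (E : Finset V) (F : V → V → ℤ) :
    ∑ w ∈ R, ∑ d ∈ NH E w, F w d = ∑ d ∈ N E, ∑ w ∈ R with w ⬝ᵥ d = 0, F w d := by
  simp only [NH, Finset.sum_filter]
  rw [Finset.sum_comm]
  simp only [dotProduct_comm]

lemma sum_k (E : Finset V) : ∑ w ∈ R, ((NH E w).card : ℤ) = 8 * (N E).card := by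
  have := comm_sum E (fun _ _ => 1)
  simp only [Finset.sum_const, nsmul_eq_mul, mul_one] at this
  rw [this]
  have h2 : ∀ d ∈ N E, ((R.filter fun w => w ⬝ᵥ d = 0).card : ℤ) = 8 := by
    intro d hd
    rw [R_perp d (R_ne ((mem_N _ _).1 hd).1)]; rfl
  rw [Finset.sum_congr rfl h2, Finset.sum_const, nsmul_eq_mul, mul_comm]

lemma sum_k_at (E : Finset V) (d : V) (hd : d ∈ N E) :
    ∑ w ∈ R with w ⬝ᵥ d = 0, ((NH E w).card : ℤ) = (N E).card + 7 := by
  have hdR := ((mem_N _ _).1 hd).1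
  have h1 : ∑ w ∈ R with w ⬝ᵥ d = 0, ((NH E w).card : ℤ) =
      ∑ d' ∈ N E, ((R.filter fun w => w ⬝ᵥ d = 0 ∧ w ⬝ᵥ d' = 0).card : ℤ) := by
    simp only [NH, Finset.card_filter]
    push_cast
    rw [Finset.sum_comm]
    apply Finset.sum_congr rfl
    intro d' _
    rw [Finset.sum_filter]
    apply Finset.sum_congr rfl
    intro w _
    simp only [ite_and, dotProduct_comm d' w]
  rw [h1, ← Finset.add_sum_erase _ _ hd]
  have h2 : ∀ d' ∈ (N E).erase d, ((R.filter fun w => w ⬝ᵥ d = 0 ∧ w ⬝ᵥ d' = 0).card : ℤ) = 1 := by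
    intro d' hd'
    have hne := Finset.ne_of_mem_erase hd'
    have hd'R := ((mem_N _ _).1 (Finset.mem_of_mem_erase hd')).1
    rw [R_perp2 d d' (R_ne hdR) (R_indep hd'R hdR hne)]; rfl
  rw [Finset.sum_congr rfl h2, Finset.sum_const, Finset.card_erase_of_mem hd]
  simp only [and_self]
  rw [R_perp d (R_ne hdR)]
  have : 0 < (N E).card := Finset.card_pos.2 ⟨d, hd⟩
  simp
  push_cast [Nat.cast_sub (show 1 ≤ (N E).card from this)]
  ring

theorem combinatorial (E A : Finset V) (hE : E.card = 28) (hA : A.card = 28) (h : Dual E A)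
    (h' : Dual A E) : False := by
  have ty := NH_types E A hE hA h h'
  have at4 : ∀ d ∈ N E, ∑ w ∈ R with w ⬝ᵥ d = 0, (4 - ((NH E w).card : ℤ)) = 25 - (N E).card := by
    intro d hd
    rw [Finset.sum_sub_distrib, sum_k_at E d hd, Finset.sum_const,
      R_perp d (R_ne ((mem_N _ _).1 hd).1)]
    simp; ring
  have h1 := comm_sum E (fun w d => (4 - ((NH E w).card : ℤ)) * (sq E d - 112))
  have h2 : ∀ w ∈ R, ∑ d ∈ NH E w, (4 - ((NH E w).card : ℤ)) * (sq E d - 112) =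
      84 * (4 - ((NH E w).card : ℤ)) := by
    intro w hw
    rcases ty w hw with ⟨hk, hd⟩ | ⟨hk, hd⟩ | hk
    · rw [Finset.sum_congr rfl (fun d h => by rw [hd d h]), Finset.sum_const, hk]; norm_num
    · rw [Finset.sum_congr rfl (fun d h => by rw [hd d h]), Finset.sum_const, hk]; norm_num
    · rw [hk]; simp
  rw [Finset.sum_congr rfl h2, ← Finset.mul_sum, Finset.sum_sub_distrib, sum_k, Finset.sum_const,
    R_card] at h1
  have h3 : ∀ d ∈ N E, ∑ w ∈ R with w ⬝ᵥ d = 0, (4 - ((NH E w).card : ℤ)) * (sq E d - 112) =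
      (25 - (N E).card) * (sq E d - 112) := by
    intro d hd
    rw [← Finset.sum_mul, at4 d hd]
  rw [Finset.sum_congr rfl h3, ← Finset.mul_sum, sum_sq_N E hE] at h1
  have hn : ((N E).card : ℤ) = 21 := by
    simp at h1
    linarith
  have h5 : ∀ d ∈ N E, sq E d - 112 = 28 := by
    intro d hd
    have hs := at4 d hd
    rw [hn] at hs
    have hin : ∀ w ∈ R.filter (fun w => w ⬝ᵥ d = 0), w ∈ R ∧ d ∈ NH E w := by
      intro w hw
      rw [Finset.mem_filter] at hw
      exact ⟨hw.1, (mem_NH _ _ _).2 ⟨hd, by rw [dotProduct_comm]; exact hw.2⟩⟩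
    by_cases hB : sq E d = 140
    · rw [hB]; norm_num
    · exfalso
      have h3 : (3 : ℤ) ∣ ∑ w ∈ R with w ⬝ᵥ d = 0, (4 - ((NH E w).card : ℤ)) := by
        apply Finset.dvd_sum
        intro w hw
        obtain ⟨hwR, hdw⟩ := hin w hw
        rcases ty w hwR with ⟨hk, _⟩ | ⟨hk, h140⟩ | hk
        · rw [hk]; norm_num
        · exact absurd (h140 d hdw) hB
        · rw [hk]; norm_num
      rw [hs] at h3
      norm_num at h3
  have h6 := sum_sq_N E hE
  rw [Finset.sum_congr rfl h5, Finset.sum_const, nsmul_eq_mul, hn] at h6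
  norm_num at h6

lemma chr_eq (a x : V) : chr 7 a x = ZMod.stdAddChar (x ⬝ᵥ a) := by
  have := ZMod.stdAddChar_coe (N := 7) ((x ⬝ᵥ a).val : ℤ)
  simp only [Int.cast_natCast, ZMod.natCast_zmod_val] at this
  rw [this]
  unfold chr
  rfl

lemma chr_mul_conj (a b x : V) :
    chr 7 a x * (starRingEnd ℂ) (chr 7 b x) = ZMod.stdAddChar (x ⬝ᵥ (a - b)) := by
  rw [chr_eq, chr_eq, dotProduct_sub, sub_eq_add_neg, AddChar.map_add_eq_mul, AddChar.map_neg_eq_conj]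

lemma chr_mul_conj2 (a x y : V) :
    chr 7 a x * (starRingEnd ℂ) (chr 7 a y) = ZMod.stdAddChar (a ⬝ᵥ (x - y)) := by
  rw [chr_eq, chr_eq, dotProduct_sub, sub_eq_add_neg, AddChar.map_add_eq_mul, AddChar.map_neg_eq_conj,
    dotProduct_comm x, dotProduct_comm y]

lemma equi_of_sum (n : ZMod 7 → ℕ) (h : ∑ t, (n t : ℂ) * ZMod.stdAddChar t = 0) (t : ZMod 7) :
    n t = n 6 := by
  set z : ℂ := Complex.exp (2 * Real.pi * Complex.I / (7 : ℕ)) with hz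
  have hp : IsPrimitiveRoot z 7 := Complex.isPrimitiveRoot_exp 7 (by norm_num)
  have hchar : ∀ k : ℕ, (ZMod.stdAddChar (k : ZMod 7) : ℂ) = z ^ k := by
    intro k
    have := ZMod.stdAddChar_coe (N := 7) (k : ℤ)
    simp only [Int.cast_natCast] at this
    rw [this, hz, ← Complex.exp_nat_mul]
    congr 1
    push_cast
    ring
  have hdeg : (minpoly ℚ z).natDegree = 6 := by
    rw [← Polynomial.cyclotomic_eq_minpoly_rat hp (by norm_num), Polynomial.natDegree_cyclotomic]
    decide
  have hli := linearIndependent_pow (K := ℚ) z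
  rw [hdeg] at hli
  rw [Fintype.linearIndependent_iff] at hli
  have geo : ∑ i ∈ range 7, z ^ i = 0 := hp.geom_sum_eq_zero (by norm_num)
  have hh : ∑ k : Fin 7, (n k : ℂ) * z ^ (k : ℕ) = 0 := by
    rw [← h]
    change ∑ k : ZMod 7, (n k : ℂ) * z ^ (ZMod.val k) = _
    apply Finset.sum_congr rfl
    intro k _
    rw [← hchar, ZMod.natCast_zmod_val]
  have h0 := hli (fun i => (n ((i : ℕ) : ZMod 7) : ℚ) - n 6) (by
    simp only [Algebra.smul_def]
    rw [Fin.sum_univ_seven] at hh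
    simp only [Finset.sum_range_succ, Finset.sum_range_zero] at geo
    simp [Fin.sum_univ_six] at hh ⊢
    have e6 : (n (6 : ZMod 7) : ℂ) = n (6 : Fin 7) := rfl
    have e5 : (n (5 : ZMod 7) : ℂ) = n (5 : Fin 7) := rfl
    have e4 : (n (4 : ZMod 7) : ℂ) = n (4 : Fin 7) := rfl
    have e3 : (n (3 : ZMod 7) : ℂ) = n (3 : Fin 7) := rfl
    have e2 : (n (2 : ZMod 7) : ℂ) = n (2 : Fin 7) := rfl
    have e1 : (n (1 : ZMod 7) : ℂ) = n (1 : Fin 7) := rfl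
    have e0 : (n (0 : ZMod 7) : ℂ) = n (0 : Fin 7) := rfl
    rw [e6, e5, e4, e3, e2, e1, e0]
    linear_combination hh - (n (6 : Fin 7) : ℂ) * geo)
  by_cases ht : t.val < 6
  · have := h0 ⟨t.val, ht⟩
    simp only [ZMod.natCast_zmod_val] at this
    have : (n t : ℚ) = n 6 := by linarith
    exact_mod_cast this
  · have h1 : t.val < 7 := ZMod.val_lt t
    have h2 : t.val = 6 := by omega
    have : t = 6 := by
      rw [← ZMod.natCast_zmod_val t, h2]; rfl
    rw [this]

lemma equi (E : Finset V) (hE : E.card = 28) (d : V)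
    (h : ∑ x ∈ E, (ZMod.stdAddChar (x ⬝ᵥ d) : ℂ) = 0) (t : ZMod 7) : cnt E d t = 4 := by
  have h1 : ∑ t, (cnt E d t : ℂ) * ZMod.stdAddChar t = 0 := by
    rw [← h, ← Finset.sum_fiberwise E (fun x => x ⬝ᵥ d)]
    apply Finset.sum_congr rfl
    intro t _
    rw [Finset.sum_congr rfl (g := fun _ => (ZMod.stdAddChar t : ℂ))
      (by intro x hx; simp at hx; rw [hx.2])]
    rw [Finset.sum_const, nsmul_eq_mul]
    rfl
  have h2 := equi_of_sum _ h1
  have h3 := sum_cnt E d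
  rw [Finset.sum_congr rfl (fun t _ => h2 t), hE, Finset.sum_const] at h3
  simp at h3
  rw [h2 t]; omega

lemma spectral_card {E A : Finset V} (h : IsSpectralPair 7 E A) : A.card = E.card := by
  obtain ⟨_, h2, h3⟩ := h
  let T : (A → ℂ) →ₗ[ℂ] (E → ℂ) :=
    { toFun := fun c x => ∑ a : A, c a * chr 7 a.1 x.1
      map_add' := by
        intro c c'; ext x; simp [add_mul, Finset.sum_add_distrib]
      map_smul' := by
        intro r c; ext x; simp [Finset.mul_sum, mul_assoc] }
  have hinj : Function.Injective T := by
    rw [injective_iff_map_eq_zero]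
    intro c hc
    ext a
    exact h3 c (fun x => congrFun hc x) a
  have hsurj : Function.Surjective T := by
    intro f
    obtain ⟨c, hc⟩ := h2 f
    exact ⟨c, by ext x; exact (hc x).symm⟩
  have := (LinearEquiv.ofBijective T ⟨hinj, hsurj⟩).finrank_eq
  simpa using this

lemma spectral_dual {E A : Finset V} (hE : E.card = 28) (h : IsSpectralPair 7 E A) :
    Dual E A ∧ Dual A E := by
  have hA := (spectral_card h).trans hE
  obtain ⟨h1, h2, _⟩ := h
  constructor
  · intro a ha b hb hab t
    apply equi E hE
    rw [← h1 a ha b hb hab]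
    exact Finset.sum_congr rfl (fun x _ => (chr_mul_conj a b x).symm)
  · intro x hx y hy hxy t
    apply equi A hA
    obtain ⟨c, hc⟩ := h2 (fun z => if z.1 = y then 1 else 0)
    have hcb : ∀ b : A, 28 * c b = (starRingEnd ℂ) (chr 7 b.1 y) := by
      intro b
      have e1 : ∑ z : E, (if z.1 = y then (1 : ℂ) else 0) * (starRingEnd ℂ) (chr 7 b.1 z.1) =
          (starRingEnd ℂ) (chr 7 b.1 y) := by
        rw [Finset.sum_coe_sort E (fun z => (if z = y then (1 : ℂ) else 0) * (starRingEnd ℂ) (chr 7 b.1 z))]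
        simp [hy]
      rw [← e1]
      have e2 : ∀ z : E, (if z.1 = y then (1 : ℂ) else 0) * (starRingEnd ℂ) (chr 7 b.1 z.1) =
          ∑ a : A, c a * (chr 7 a.1 z.1 * (starRingEnd ℂ) (chr 7 b.1 z.1)) := by
        intro z
        rw [hc z, Finset.sum_mul]
        exact Finset.sum_congr rfl (fun a _ => by ring)
      rw [Finset.sum_congr rfl (fun z _ => e2 z), Finset.sum_comm]
      rw [Finset.sum_eq_single b]
      · rw [← Finset.mul_sum]
        have : ∀ z : E, chr 7 b.1 z.1 * (starRingEnd ℂ) (chr 7 b.1 z.1) = 1 := by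
          intro z
          rw [chr_mul_conj, sub_self, dotProduct_zero, AddChar.map_zero_eq_one]
        rw [Finset.sum_congr rfl (fun z _ => this z)]
        simp [hE]
        ring
      · intro a _ hab
        rw [← Finset.mul_sum]
        have := h1 a.1 a.2 b.1 b.2 (fun h => hab (Subtype.ext h))
        rw [← Finset.sum_coe_sort] at this
        rw [this, mul_zero]
      · simp
    have h0 := hc ⟨x, hx⟩
    simp only [hxy, if_false] at h0
    have : ∑ a : A, (ZMod.stdAddChar (a.1 ⬝ᵥ (x - y)) : ℂ) = 0 := by
      rw [← mul_zero (28 : ℂ), h0, Finset.mul_sum]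
      apply Finset.sum_congr rfl
      intro a _
      rw [← mul_assoc, hcb a, ← chr_mul_conj2, mul_comm]
    rw [← Finset.sum_coe_sort]
    exact this

end Sp

/-- There is no spectral set of size 28 in `𝔽_7^3`. -/
theorem no_spectral_of_card_28 (E : Finset (Fin 3 → ZMod 7)) (hE : E.card = 28) :
    ¬ IsSpectral 7 E := by
  rintro ⟨A, h⟩
  have hd := Sp.spectral_dual hE h
  exact Sp.combinatorial E A hE ((Sp.spectral_card h).trans hE) hd.1 hd.2
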